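/- arXiv:2001.02489 — 6 statements merged into one kernel-verified Lean document; each statement's English description precedes it below -/
import Mathlib

section
/- Fix real numbers β < 0 and θ₂, θ₃ ∈ ℝ, and for T large enough that β² − 2(θ₂βe^{βT} + θ₃e^{2βT}) > 0 (which holds for all sufficiently large T, since e^{βT} → 0 as T → ∞), define β₁(T) = −√(β² − 2(θ₂βe^{βT} + θ₃e^{2βT})). Then, as T → ∞, β₁(T) = β − θ₂e^{βT} + ((θ₂² + 2θ₃)/(2(−β))) e^{2βT} + O(e^{3βT}); that is, the function T ↦ β₁(T) − β + θ₂e^{βT} − ((θ₂² + 2θ₃)/(−2β)) e^{2βT} is big-O of T ↦ e^{3βT} as T → ∞. -/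
open Filter Real

/-- Second-order expansion at `0` of the square root of a quadratic polynomial. -/
theorem sqrt_quadratic_expansion_isBigO {b : ℝ} (hb : 0 < b) (p q : ℝ) :
    (fun x : ℝ => √(b ^ 2 + 2 * p * b * x - 2 * q * x ^ 2)
        - (b + p * x - (p ^ 2 + 2 * q) / (2 * b) * x ^ 2))
      =O[nhds 0] fun x : ℝ => x ^ 3 := by
  set c := (p ^ 2 + 2 * q) / (2 * b) with hc
  have hbc : 2 * b * c = p ^ 2 + 2 * q := by rw [hc]; field_simp
  have radicand_pos : ∀ᶠ x : ℝ in nhds 0, 0 < b ^ 2 + 2 * p * b * x - 2 * q * x ^ 2 := by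
    have h : ContinuousAt (fun x : ℝ => b ^ 2 + 2 * p * b * x - 2 * q * x ^ 2) 0 := by fun_prop
    exact h.eventually (lt_mem_nhds (by simp; positivity))
  have approx_lower : ∀ᶠ x : ℝ in nhds 0, b / 2 < b + p * x - c * x ^ 2 := by
    have h : ContinuousAt (fun x : ℝ => b + p * x - c * x ^ 2) 0 := by fun_prop
    exact h.eventually (lt_mem_nhds (by simp; linarith))
  have factor_bound : ∀ᶠ x : ℝ in nhds 0, |2 * p * c - c ^ 2 * x| < |2 * p * c| + 1 := by
    have h : ContinuousAt (fun x : ℝ => |2 * p * c - c ^ 2 * x|) 0 := by fun_prop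
    exact h.eventually (gt_mem_nhds (by simp))
  refine Asymptotics.IsBigO.of_bound ((|2 * p * c| + 1) / (b / 2)) ?_
  filter_upwards [radicand_pos, approx_lower, factor_bound] with x hD hP hF
  set S := √(b ^ 2 + 2 * p * b * x - 2 * q * x ^ 2)
  set P := b + p * x - c * x ^ 2 with hPdef
  have hS : S ^ 2 = b ^ 2 + 2 * p * b * x - 2 * q * x ^ 2 := Real.sq_sqrt hD.le
  have hS0 : 0 ≤ S := Real.sqrt_nonneg _
  have key : (S - P) * (S + P) = (2 * p * c - c ^ 2 * x) * x ^ 3 := by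
    rw [hPdef]
    linear_combination hS + x ^ 2 * hbc
  have habs : |S - P| * (S + P) = |2 * p * c - c ^ 2 * x| * |x ^ 3| := by
    rw [← abs_mul, ← key, abs_mul, abs_of_pos (by linarith : 0 < S + P)]
  rw [Real.norm_eq_abs, Real.norm_eq_abs, div_mul_eq_mul_div, le_div_iff₀ (by positivity)]
  calc |S - P| * (b / 2) ≤ |S - P| * (S + P) := by gcongr; linarith
    _ = |2 * p * c - c ^ 2 * x| * |x ^ 3| := habs
    _ ≤ (|2 * p * c| + 1) * |x ^ 3| := by gcongr

/-- Second-order expansion of `β₁(T) = -√(β² - 2(θ₂βe^{βT} + θ₃e^{2βT}))` as `T → ∞`. -/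
theorem stmt_2 (β θ₂ θ₃ : ℝ) (hβ : β < 0) :
    (fun T : ℝ =>
        (-Real.sqrt (β ^ 2 - 2 * (θ₂ * β * Real.exp (β * T) + θ₃ * Real.exp (2 * β * T))))
          - β + θ₂ * Real.exp (β * T)
          - ((θ₂ ^ 2 + 2 * θ₃) / (2 * (-β))) * Real.exp (2 * β * T))
      =O[atTop] fun T : ℝ => Real.exp (3 * β * T) := by
  have hlim : Tendsto (fun T : ℝ => Real.exp (β * T)) atTop (nhds 0) :=
    Real.tendsto_exp_atBot.comp (tendsto_id.const_mul_atTop_of_neg hβ)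
  have h2 (T : ℝ) : Real.exp (2 * β * T) = Real.exp (β * T) ^ 2 := by
    rw [← Real.exp_nat_mul]; push_cast; ring_nf
  have h3 (T : ℝ) : Real.exp (3 * β * T) = Real.exp (β * T) ^ 3 := by
    rw [← Real.exp_nat_mul]; push_cast; ring_nf
  have h := ((sqrt_quadratic_expansion_isBigO (neg_pos.mpr hβ) θ₂ θ₃).comp_tendsto hlim).neg_left
  refine h.congr (fun T => ?_) (fun T => (h3 T).symm)
  simp only [Function.comp_apply, h2]
  have hD : (-β) ^ 2 + 2 * θ₂ * -β * Real.exp (β * T) - 2 * θ₃ * Real.exp (β * T) ^ 2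
      = β ^ 2 - 2 * (θ₂ * β * Real.exp (β * T) + θ₃ * Real.exp (β * T) ^ 2) := by ring
  rw [hD]
  ring
end

section
/- Fix real numbers β < 0, α ∈ ℝ, γ > 0, θ₁, θ₂, θ₃ ∈ ℝ, and H ∈ (1/2, 1). For T large enough that β² − 2(θ₂βe^{βT} + θ₃e^{2βT}) > 0, define β₁(T) = −√(β² − 2(θ₂βe^{βT} + θ₃e^{2βT})) and α₁(T) = (βγθ₁T^{H−1} + αβ)/β₁(T). Then, as T → ∞, α₁(T) = α + γθ₁T^{H−1} + (θ₂α/β) e^{βT} + (θ₂γθ₁/β) T^{H−1} e^{βT} + O(e^{2βT}); that is, the function T ↦ α₁(T) − α − γθ₁T^{H−1} − (θ₂α/β)e^{βT} − (θ₂γθ₁/β)T^{H−1}e^{βT} is big-O of T ↦ e^{2βT} as T → ∞. -/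
open Filter Real

noncomputable def beta1 (β θ₂ θ₃ T : ℝ) : ℝ :=
  -Real.sqrt (β ^ 2 - 2 * (θ₂ * β * Real.exp (β * T) + θ₃ * Real.exp (2 * β * T)))

noncomputable def alpha1 (β α γ θ₁ θ₂ θ₃ H T : ℝ) : ℝ :=
  (β * γ * θ₁ * T ^ (H - 1) + α * β) / beta1 β θ₂ θ₃ T

open Topology in
/-- First-order Taylor expansion at `0` of `β / -√(β² - 2(aβx + bx²))` for `β < 0`. -/
theorem div_neg_sqrt_sub_isBigO_sq (β a b : ℝ) (hβ : β < 0) :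
    (fun x : ℝ => β / -√(β ^ 2 - 2 * (a * β * x + b * x ^ 2)) - 1 - a / β * x)
      =O[𝓝 0] fun x : ℝ => x ^ 2 := by
  set S : ℝ → ℝ := fun x => √(β ^ 2 - 2 * (a * β * x + b * x ^ 2)) with hS
  set P : ℝ → ℝ := fun x => 3 * a ^ 2 + 2 * b + (2 * a ^ 3 / β + 4 * a * b / β) * x
    + 2 * b * a ^ 2 / β ^ 2 * x ^ 2 with hP
  have hS0 : S 0 = -β := by simp [hS, Real.sqrt_sq_eq_abs, abs_of_neg hβ]
  have hSc : ContinuousAt S 0 := by fun_prop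
  have hDc : ContinuousAt (fun x => -β + S x * (1 + a / β * x)) 0 := by fun_prop
  have hD0 : 0 < -β + S 0 * (1 + a / β * 0) := by rw [hS0]; linarith
  have hSpos : ∀ᶠ x in 𝓝 0, 0 < S x := hSc.eventually_const_lt (by rw [hS0]; linarith)
  have hDpos := hDc.eventually_const_lt hD0
  have hQ : ContinuousAt (fun x => P x / (S x * (-β + S x * (1 + a / β * x)))) 0 := by
    refine ContinuousAt.div (by fun_prop) (hSc.mul hDc) (mul_ne_zero ?_ hD0.ne')
    rw [hS0]; linarith
  have hQ1 := hQ.isBigO_one ℝ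
  have h := (Asymptotics.isBigO_refl (fun x : ℝ => x ^ 2) (𝓝 0)).mul hQ1
  simp only [mul_one] at h
  refine h.congr' ?_ EventuallyEq.rfl
  filter_upwards [hSpos, hDpos] with x hx hd
  have hsq : S x ^ 2 = β ^ 2 - 2 * (a * β * x + b * x ^ 2) :=
    Real.sq_sqrt (Real.sqrt_pos.mp hx).le
  have hnum : x ^ 2 * P x = β ^ 2 - S x ^ 2 * (1 + a / β * x) ^ 2 := by
    rw [hsq, hP]
    field_simp [hβ.ne]
    ring
  change x ^ 2 * (P x / (S x * (-β + S x * (1 + a / β * x)))) = β / -S x - 1 - a / β * x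
  rw [← mul_div_assoc, hnum, div_eq_iff (mul_pos hx hd).ne']
  generalize a / β * x = y
  field_simp
  ring

/-- Asymptotic expansion of `α₁(T)` as `T → ∞`. -/
theorem stmt_3 (β α γ θ₁ θ₂ θ₃ H : ℝ) (hβ : β < 0) (hγ : 0 < γ)
    (hH₁ : 1 / 2 < H) (hH₂ : H < 1) :
    (fun T : ℝ =>
        alpha1 β α γ θ₁ θ₂ θ₃ H T - α - γ * θ₁ * T ^ (H - 1)
          - (θ₂ * α / β) * Real.exp (β * T)
          - (θ₂ * γ * θ₁ / β) * T ^ (H - 1) * Real.exp (β * T))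
      =O[atTop] fun T : ℝ => Real.exp (2 * β * T) := by
  have hexp : ∀ T : ℝ, Real.exp (2 * β * T) = Real.exp (β * T) ^ 2 := fun T => by
    rw [← Real.exp_nat_mul]; congr 1; push_cast; ring
  have hlim : Tendsto (fun T : ℝ => Real.exp (β * T)) atTop (nhds 0) :=
    Real.tendsto_exp_atBot.comp (tendsto_id.const_mul_atTop_of_neg hβ)
  have hpow : Tendsto (fun T : ℝ => T ^ (H - 1)) atTop (nhds 0) := by
    simpa using tendsto_rpow_neg_atTop (sub_pos.mpr hH₂)
  have hcoef := ((hpow.const_mul (γ * θ₁)).add_const α).isBigO_one ℝ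
  have h := hcoef.mul ((div_neg_sqrt_sub_isBigO_sq β θ₂ θ₃ hβ).comp_tendsto hlim)
  refine h.congr (fun T => ?_) (fun T => ?_)
  · simp only [Function.comp_apply, alpha1, beta1, hexp]
    ring
  · simp only [Function.comp_apply, hexp, one_mul]
end

section
/- Fix real numbers β < 0, α ∈ ℝ, γ > 0, θ₁, θ₂, θ₃ ∈ ℝ, and H ∈ (1/2, 1). For T large enough that β² − 2(θ₂βe^{βT} + θ₃e^{2βT}) > 0, define β₁(T) = −√(β² − 2(θ₂βe^{βT} + θ₃e^{2βT})), α₁(T) = (βγθ₁T^{H−1} + αβ)/β₁(T), and ξ₁(T) = θ₁T^{H−1} + (α − α₁(T))/γ. Then, as T → ∞, ξ₁(T) = (θ₂α/(−βγ)) e^{βT} + (θ₁θ₂/(−β)) T^{H−1} e^{βT} + O(e^{2βT}); that is, the function T ↦ ξ₁(T) − (θ₂α/(−βγ))e^{βT} − (θ₁θ₂/(−β))T^{H−1}e^{βT} is big-O of T ↦ e^{2βT} as T → ∞. -/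
open Filter Real

noncomputable def xi1 (β α γ θ₁ θ₂ θ₃ H T : ℝ) : ℝ :=
  θ₁ * T ^ (H - 1) + (α - alpha1 β α γ θ₁ θ₂ θ₃ H T) / γ

/-- Exact second-order remainder of `1 - b / s` in `x`, where
`s ^ 2 = b ^ 2 + 2 * p * b * x - 2 * q * x ^ 2`. -/
theorem one_sub_div_sub_eq_sq_mul {b p q x s : ℝ} (hb : b ≠ 0) (hs : s ≠ 0)
    (hsu : s + (b + p * x) ≠ 0)
    (h : s ^ 2 = b ^ 2 + 2 * p * b * x - 2 * q * x ^ 2) :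
    1 - b / s - p * x / b =
      x ^ 2 * ((-(p ^ 2 + 2 * q) / (s + (b + p * x)) * (1 - p * x / b) - p ^ 2 / b) / s) := by
  have h₁ : s - (b + p * x) = x ^ 2 * (-(p ^ 2 + 2 * q) / (s + (b + p * x))) := by
    rw [mul_div_assoc', eq_div_iff hsu]
    linear_combination h
  have h₂ : x ^ 2 * ((-(p ^ 2 + 2 * q) / (s + (b + p * x)) * (1 - p * x / b) - p ^ 2 / b) / s)
      = ((s - (b + p * x)) * (1 - p * x / b) - x ^ 2 * p ^ 2 / b) / s := by
    rw [h₁]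
    ring
  rw [h₂]
  field_simp
  ring

/-- Asymptotic expansion of `ξ₁(T)` as `T → ∞`. -/
theorem stmt_4 (β α γ θ₁ θ₂ θ₃ H : ℝ) (hβ : β < 0) (hγ : 0 < γ)
    (hH₁ : 1 / 2 < H) (hH₂ : H < 1) :
    (fun T : ℝ =>
        xi1 β α γ θ₁ θ₂ θ₃ H T - (θ₂ * α / (-β * γ)) * Real.exp (β * T)
          - (θ₁ * θ₂ / (-β)) * T ^ (H - 1) * Real.exp (β * T))
      =O[atTop] fun T : ℝ => Real.exp (2 * β * T) := by
  have hx : Tendsto (fun T : ℝ => exp (β * T)) atTop (nhds 0) :=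
    tendsto_exp_atBot.comp (tendsto_id.const_mul_atTop_of_neg hβ)
  have hpow : Tendsto (fun T : ℝ => T ^ (H - 1)) atTop (nhds 0) := by
    simpa using tendsto_rpow_neg_atTop (sub_pos.2 hH₂)
  have hb : 0 < -β := neg_pos.2 hβ
  have hexp (T : ℝ) : exp (2 * β * T) = exp (β * T) ^ 2 := by
    rw [← exp_nat_mul]
    congr 1
    push_cast
    ring
  set D : ℝ → ℝ := fun T =>
    β ^ 2 - 2 * (θ₂ * β * exp (β * T) + θ₃ * exp (2 * β * T)) with hD
  have hD_lim : Tendsto D atTop (nhds (β ^ 2)) := by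
    simp only [hD, hexp]
    simpa using (((hx.const_mul (θ₂ * β)).add ((hx.pow 2).const_mul θ₃)).const_mul 2).const_sub
      (β ^ 2)
  have hs : Tendsto (fun T => √(D T)) atTop (nhds (-β)) := by
    simpa [sqrt_sq_eq_abs, abs_of_neg hβ] using hD_lim.sqrt
  have hpx : Tendsto (fun T => θ₂ * exp (β * T)) atTop (nhds 0) := by
    simpa using hx.const_mul θ₂
  have hsu : Tendsto (fun T => √(D T) + (-β + θ₂ * exp (β * T))) atTop (nhds (-β + (-β + 0))) :=
    hs.add (hpx.const_add (-β))
  have hsu_pos : 0 < -β + (-β + 0) := by linarith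
  have hR := ((((tendsto_const_nhds (x := -(θ₂ ^ 2 + 2 * θ₃))).div hsu hsu_pos.ne').mul
    ((hpx.div_const (-β)).const_sub 1)).sub_const (θ₂ ^ 2 / (-β))).div hs hb.ne'
  have hG := ((hpow.const_mul θ₁).add_const (α / γ)).mul hR
  refine (((Asymptotics.isBigO_refl (fun T : ℝ => exp (2 * β * T)) atTop).mul
    (hG.isBigO_one ℝ)).congr' ?_ (by simp))
  filter_upwards [hs.eventually_const_lt hb, hsu.eventually_const_lt hsu_pos,
    hD_lim.eventually_const_lt (sq_pos_of_neg hβ)] with T hsT hsuT hDT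
  have key := one_sub_div_sub_eq_sq_mul (q := θ₃) hb.ne' hsT.ne' hsuT.ne' (by
    rw [sq_sqrt hDT.le]
    simp only [hD, hexp]
    ring)
  have hxi : xi1 β α γ θ₁ θ₂ θ₃ H T =
      (θ₁ * T ^ (H - 1) + α / γ) * (1 - -β / √(D T)) := by
    simp only [xi1, alpha1, beta1]
    change θ₁ * T ^ (H - 1) + (α - (β * γ * θ₁ * T ^ (H - 1) + α * β) / -√(D T)) / γ = _
    field_simp
    ring
  have hsplit : (θ₁ * T ^ (H - 1) + α / γ) * (1 - -β / √(D T) - θ₂ * exp (β * T) / -β) =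
      xi1 β α γ θ₁ θ₂ θ₃ H T - (θ₂ * α / (-β * γ)) * exp (β * T)
        - (θ₁ * θ₂ / (-β)) * T ^ (H - 1) * exp (β * T) := by
    rw [hxi]
    field_simp
    ring
  rw [← hsplit, key, hexp]
  simp only [Pi.div_apply]
  ring
end

section
/- Fix real numbers β < 0 and θ₂, θ₃ ∈ ℝ. For T large enough that β² − 2(θ₂βe^{βT} + θ₃e^{2βT}) > 0, define β₁(T) = −√(β² − 2(θ₂βe^{βT} + θ₃e^{2βT})) and ξ₂(T) = θ₂e^{βT} − β + β₁(T). Then, as T → ∞, ξ₂(T) = ((θ₂² + 2θ₃)/(−2β)) e^{2βT} + O(e^{3βT}); that is, the function T ↦ ξ₂(T) − ((θ₂² + 2θ₃)/(−2β))e^{2βT} is big-O of T ↦ e^{3βT} as T → ∞. -/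
open Filter Real

noncomputable def xi2 (β θ₂ θ₃ T : ℝ) : ℝ :=
  θ₂ * Real.exp (β * T) - β + beta1 β θ₂ θ₃ T

/-- Asymptotic expansion of `ξ₂(T)` as `T → ∞`. -/
theorem stmt_5 (β θ₂ θ₃ : ℝ) (hβ : β < 0) :
    (fun T : ℝ =>
        xi2 β θ₂ θ₃ T - ((θ₂ ^ 2 + 2 * θ₃) / (-2 * β)) * Real.exp (2 * β * T))
      =O[atTop] fun T : ℝ => Real.exp (3 * β * T) := by
  obtain ⟨c, hc⟩ : ∃ c, c = (θ₂ ^ 2 + 2 * θ₃) / (-2 * β) := ⟨_, rfl⟩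
  have hcβ : c * (-2 * β) = θ₂ ^ 2 + 2 * θ₃ := by
    rw [hc, div_mul_cancel₀]
    linarith
  have hx : Tendsto (fun T : ℝ => Real.exp (β * T)) atTop (nhds 0) :=
    Real.tendsto_exp_atBot.comp (tendsto_id.const_mul_atTop_of_neg hβ)
  have hP : Tendsto (fun T : ℝ => -β + θ₂ * Real.exp (β * T) - c * Real.exp (β * T) ^ 2)
      atTop (nhds (-β)) := by
    simpa using ((hx.const_mul θ₂).const_add (-β)).sub ((hx.pow 2).const_mul c)
  have hD : Tendsto (fun T : ℝ => β ^ 2 -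
      2 * (θ₂ * β * Real.exp (β * T) + θ₃ * Real.exp (β * T) ^ 2)) atTop (nhds (β ^ 2)) := by
    simpa using (((hx.const_mul (θ₂ * β)).add ((hx.pow 2).const_mul θ₃)).const_mul 2).const_sub
      (β ^ 2)
  refine Asymptotics.IsBigO.of_bound ((c ^ 2 + 2 * |θ₂ * c|) / (-β / 2)) ?_
  filter_upwards [hx.eventually_le_const one_pos,
    hP.eventually_const_le (show -β / 2 < -β by linarith),
    hD.eventually_const_le (sq_pos_of_neg hβ)] with T hx1 hP1 hD1
  have e2 : Real.exp (2 * β * T) = Real.exp (β * T) ^ 2 := by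
    rw [← Real.exp_nat_mul]; push_cast; ring_nf
  have e3 : Real.exp (3 * β * T) = Real.exp (β * T) ^ 3 := by
    rw [← Real.exp_nat_mul]; push_cast; ring_nf
  have hx0 := Real.exp_pos (β * T)
  rw [← hc, xi2, beta1, e2, e3]
  generalize Real.exp (β * T) = x at *
  have hs := Real.sq_sqrt hD1
  have hs0 := Real.sqrt_nonneg (β ^ 2 - 2 * (θ₂ * β * x + θ₃ * x ^ 2))
  generalize √(β ^ 2 - 2 * (θ₂ * β * x + θ₃ * x ^ 2)) = s at *
  rw [Real.norm_eq_abs, Real.norm_of_nonneg (by positivity), div_mul_eq_mul_div,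
    le_div_iff₀ (by linarith)]
  have key : (θ₂ * x - β + -s - c * x ^ 2) * (-β + θ₂ * x - c * x ^ 2 + s)
      = (c ^ 2 * x - 2 * (θ₂ * c)) * x ^ 3 := by
    linear_combination -hs - x ^ 2 * hcβ
  calc |θ₂ * x - β + -s - c * x ^ 2| * (-β / 2)
      ≤ |θ₂ * x - β + -s - c * x ^ 2| * (-β + θ₂ * x - c * x ^ 2 + s) := by
        gcongr
        linarith
    _ = |c ^ 2 * x - 2 * (θ₂ * c)| * x ^ 3 := by
        rw [← abs_of_nonneg (show 0 ≤ -β + θ₂ * x - c * x ^ 2 + s by linarith), ← abs_mul, key, abs_mul,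
          abs_of_nonneg (show 0 ≤ x ^ 3 by positivity)]
    _ ≤ (c ^ 2 + 2 * |θ₂ * c|) * x ^ 3 := by
        gcongr
        have h1 : c ^ 2 * x ≤ c ^ 2 := mul_le_of_le_one_right (sq_nonneg c) hx1
        have h2 : 0 ≤ c ^ 2 * x := by positivity
        rw [abs_le]
        constructor <;> linarith [le_abs_self (θ₂ * c), neg_abs_le (θ₂ * c)]
end

section
/- Fix real numbers β < 0, α ∈ ℝ, γ > 0, θ₁, θ₂, θ₃ ∈ ℝ, and H ∈ (1/2, 1). For T large enough that β² − 2(θ₂βe^{βT} + θ₃e^{2βT}) > 0, define β₁(T) = −√(β² − 2(θ₂βe^{βT} + θ₃e^{2βT})), α₁(T) = (βγθ₁T^{H−1} + αβ)/β₁(T), ξ₁(T) = θ₁T^{H−1} + (α − α₁(T))/γ, and ξ₂(T) = θ₂e^{βT} − β + β₁(T). Then, as T → ∞: (i) ξ₁(T)² = (θ₂²α²/(β²γ²)) e^{2βT} + O(T^{H−1}e^{2βT}); (ii) ξ₁(T)·ξ₂(T) = O(e^{3βT}); and (iii) ξ₂(T)² = O(e^{4βT}). -/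
open Filter Real

open Asymptotics Topology

lemma tendsto_exp_mul_atTop_of_neg {β : ℝ} (hβ : β < 0) :
    Tendsto (fun T : ℝ => exp (β * T)) atTop (𝓝 0) :=
  tendsto_exp_atBot.comp (tendsto_id.const_mul_atTop_of_neg hβ)

lemma exp_nat_mul_mul (n : ℕ) (β T : ℝ) : exp (n * β * T) = exp (β * T) ^ n := by
  rw [← exp_nat_mul, mul_assoc]

lemma tendsto_beta1 {β : ℝ} (hβ : β < 0) (θ₂ θ₃ : ℝ) :
    Tendsto (beta1 β θ₂ θ₃) atTop (𝓝 β) := by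
  unfold beta1
  have h₁ := tendsto_exp_mul_atTop_of_neg hβ
  have h₂ := tendsto_exp_mul_atTop_of_neg (mul_neg_of_pos_of_neg two_pos hβ)
  have h := ((((h₁.const_mul (θ₂ * β)).add (h₂.const_mul θ₃)).const_mul 2).const_sub
    (β ^ 2)).sqrt.neg
  simpa [sqrt_sq_eq_abs, abs_of_neg hβ] using h

lemma beta1_sq_eventually {β : ℝ} (hβ : β < 0) (θ₂ θ₃ : ℝ) :
    ∀ᶠ T in atTop, beta1 β θ₂ θ₃ T ^ 2
      = β ^ 2 - 2 * (θ₂ * β * exp (β * T) + θ₃ * exp (β * T) ^ 2) := by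
  filter_upwards [(tendsto_beta1 hβ θ₂ θ₃).eventually_lt_const hβ] with T hT
  have hpos := sqrt_pos.mp (neg_lt_zero.mp hT)
  rw [beta1, neg_sq, sq_sqrt hpos.le, ← exp_nat_mul_mul, Nat.cast_ofNat]

lemma beta1_sub_isBigO {β : ℝ} (hβ : β < 0) (θ₂ θ₃ : ℝ) :
    (fun T => beta1 β θ₂ θ₃ T - β) =O[atTop] fun T => exp (β * T) := by
  have hb := tendsto_beta1 hβ θ₂ θ₃
  have h : Tendsto (fun T => -2 * (θ₂ * β + θ₃ * exp (β * T)) / (beta1 β θ₂ θ₃ T + β)) atTop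
      (𝓝 (-2 * (θ₂ * β + θ₃ * 0) / (β + β))) :=
    ((((tendsto_exp_mul_atTop_of_neg hβ).const_mul θ₃).const_add _).const_mul _).div
      (hb.add_const β) (by linarith)
  refine ((h.isBigO_one ℝ).mul (isBigO_refl (fun T => exp (β * T)) atTop)).congr' ?_ (by simp)
  filter_upwards [beta1_sq_eventually hβ θ₂ θ₃, hb.eventually_lt_const hβ] with T hsq hneg
  have : beta1 β θ₂ θ₃ T + β ≠ 0 := by linarith
  field_simp
  linear_combination -hsq

lemma xi2_isBigO {β : ℝ} (hβ : β < 0) (θ₂ θ₃ : ℝ) :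
    xi2 β θ₂ θ₃ =O[atTop] fun T => exp (β * T) ^ 2 := by
  have hb := tendsto_beta1 hβ θ₂ θ₃
  have hx := isBigO_refl (fun T => exp (β * T)) atTop
  have hnum : (fun T => θ₂ * (exp (β * T) * (beta1 β θ₂ θ₃ T - β)) - 2 * θ₃ * exp (β * T) ^ 2)
      =O[atTop] fun T => exp (β * T) ^ 2 :=
    (((hx.mul (beta1_sub_isBigO hβ θ₂ θ₃)).congr_right fun T => (sq _).symm).const_mul_left
      θ₂).sub ((hx.pow 2).const_mul_left _)
  have hinv := ((hb.add_const β).inv₀ (by linarith)).isBigO_one ℝ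
  refine (hnum.mul hinv).congr' ?_ (by simp)
  filter_upwards [beta1_sq_eventually hβ θ₂ θ₃, hb.eventually_lt_const hβ] with T hsq hneg
  have : beta1 β θ₂ θ₃ T + β ≠ 0 := by linarith
  rw [xi2]
  field_simp
  linear_combination -hsq

lemma exp_mul_isBigO_rpow {β : ℝ} (hβ : β < 0) (s : ℝ) :
    (fun T => exp (β * T)) =O[atTop] fun T : ℝ => T ^ s := by
  simpa using (isLittleO_exp_neg_mul_rpow_atTop (neg_pos.mpr hβ) s).isBigO

lemma rpow_isBigO_one {s : ℝ} (hs : s < 0) :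
    (fun T : ℝ => T ^ s) =O[atTop] fun _ => (1 : ℝ) := by
  have h := tendsto_rpow_neg_atTop (neg_pos.mpr hs)
  rw [neg_neg] at h
  exact h.isBigO_one ℝ

lemma xi1_add_isBigO {β γ H : ℝ} (hβ : β < 0) (hγ : 0 < γ) (α θ₁ θ₂ θ₃ : ℝ) :
    (fun T => xi1 β α γ θ₁ θ₂ θ₃ H T + α * θ₂ / (β * γ) * exp (β * T))
      =O[atTop] fun T => T ^ (H - 1) * exp (β * T) := by
  have hb := tendsto_beta1 hβ θ₂ θ₃
  have hinv := (hb.inv₀ hβ.ne).isBigO_one ℝ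
  have hx := isBigO_refl (fun T => exp (β * T)) atTop
  have hp := isBigO_refl (fun T : ℝ => T ^ (H - 1)) atTop
  have hd := beta1_sub_isBigO hβ θ₂ θ₃
  have hxp := exp_mul_isBigO_rpow hβ (H - 1)
  have hxx : (fun T => exp (β * T) ^ 2) =O[atTop] fun T => T ^ (H - 1) * exp (β * T) :=
    (hxp.mul hx).congr_left fun T => (sq _).symm
  have h₁ := (hp.mul hd).const_mul_left θ₁
  have h₂ := ((xi2_isBigO hβ θ₂ θ₃).trans hxx).const_mul_left (α / γ)
  have h₃ := (hxp.mul hd).const_mul_left (α * θ₂ / (β * γ))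
  refine (((h₁.add h₂).add h₃).mul hinv).congr' ?_ (by simp)
  filter_upwards [hb.eventually_lt_const hβ] with T hneg
  have := hneg.ne
  have := hβ.ne
  rw [xi1, alpha1, xi2]
  field_simp
  ring

lemma xi1_isBigO {β γ H : ℝ} (hβ : β < 0) (hγ : 0 < γ) (hH : H < 1) (α θ₁ θ₂ θ₃ : ℝ) :
    xi1 β α γ θ₁ θ₂ θ₃ H =O[atTop] fun T => exp (β * T) := by
  have hx := isBigO_refl (fun T => exp (β * T)) atTop
  have hpx := ((rpow_isBigO_one (sub_neg.mpr hH)).mul hx).congr_right fun T => one_mul _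
  exact (((xi1_add_isBigO hβ hγ α θ₁ θ₂ θ₃).trans hpx).sub
    (hx.const_mul_left (α * θ₂ / (β * γ)))).congr_left fun T => add_sub_cancel_right _ _

/-- Asymptotics of `ξ₁(T)²`, `ξ₁(T)ξ₂(T)` and `ξ₂(T)²` as `T → ∞`. -/
theorem stmt_7 (β α γ θ₁ θ₂ θ₃ H : ℝ) (hβ : β < 0) (hγ : 0 < γ)
    (hH₁ : 1 / 2 < H) (hH₂ : H < 1) :
    ((fun T : ℝ =>
        (xi1 β α γ θ₁ θ₂ θ₃ H T) ^ 2
          - (θ₂ ^ 2 * α ^ 2 / (β ^ 2 * γ ^ 2)) * Real.exp (2 * β * T))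
      =O[atTop] fun T : ℝ => T ^ (H - 1) * Real.exp (2 * β * T))
    ∧ ((fun T : ℝ => xi1 β α γ θ₁ θ₂ θ₃ H T * xi2 β θ₂ θ₃ T)
      =O[atTop] fun T : ℝ => Real.exp (3 * β * T))
    ∧ ((fun T : ℝ => (xi2 β θ₂ θ₃ T) ^ 2)
      =O[atTop] fun T : ℝ => Real.exp (4 * β * T)) := by
  have hx := isBigO_refl (fun T => exp (β * T)) atTop
  have h₁ := xi1_isBigO hβ hγ hH₂ α θ₁ θ₂ θ₃
  have h₂ := xi2_isBigO hβ θ₂ θ₃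
  have e₂ (T : ℝ) : exp (2 * β * T) = exp (β * T) ^ 2 := mod_cast exp_nat_mul_mul 2 β T
  have e₃ (T : ℝ) : exp (3 * β * T) = exp (β * T) ^ 3 := mod_cast exp_nat_mul_mul 3 β T
  have e₄ (T : ℝ) : exp (4 * β * T) = exp (β * T) ^ 4 := mod_cast exp_nat_mul_mul 4 β T
  simp only [e₂, e₃, e₄]
  refine ⟨?_, (h₁.mul h₂).congr_right fun T => by ring, (h₂.pow 2).congr_right fun T => by ring⟩
  refine ((xi1_add_isBigO hβ hγ α θ₁ θ₂ θ₃).mul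
    (h₁.sub (hx.const_mul_left (α * θ₂ / (β * γ))))).congr (fun T => ?_) fun T => by ring
  ring
end

section
/- Fix real numbers β < 0, α ∈ ℝ, γ > 0, θ₁, θ₂, θ₃ ∈ ℝ, and H ∈ (1/2, 1), and let λ_H = 2H·Γ(3 − 2H)·Γ(H + 1/2)/Γ(3/2 − H), where Γ is the Gamma function, and w_T^H = λ_H^{-1}·T^{2−2H}. For T large enough that β² − 2(θ₂βe^{βT} + θ₃e^{2βT}) > 0, define β₁(T) = −√(β² − 2(θ₂βe^{βT} + θ₃e^{2βT})) and α₁(T) = (βγθ₁T^{H−1} + αβ)/β₁(T). Then (α₁(T)² − α²)/(2γ²) · w_T^H − (θ₁α/γ)·T^{H−1}·w_T^H converges to θ₁²/(2λ_H) as T → ∞. -/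
open Filter Real

noncomputable def lambdaH (H : ℝ) : ℝ :=
  2 * H * Real.Gamma (3 - 2 * H) * Real.Gamma (H + 1 / 2) / Real.Gamma (3 / 2 - H)

noncomputable def wH (H T : ℝ) : ℝ := (lambdaH H)⁻¹ * T ^ (2 - 2 * H)

/-- The perturbation of `β ^ 2` under the square root defining `beta1`, up to a factor `-2`. -/
noncomputable def expPerturbation (β θ₂ θ₃ T : ℝ) : ℝ :=
  θ₂ * β * Real.exp (β * T) + θ₃ * Real.exp (2 * β * T)

theorem tendsto_expPerturbation_mul_rpow {β : ℝ} (θ₂ θ₃ s : ℝ) (hβ : β < 0) :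
    Tendsto (fun T : ℝ => expPerturbation β θ₂ θ₃ T * T ^ s) atTop (nhds 0) := by
  have h₁ := tendsto_rpow_mul_exp_neg_mul_atTop_nhds_zero s (-β) (by linarith)
  have h₂ := tendsto_rpow_mul_exp_neg_mul_atTop_nhds_zero s (-(2 * β)) (by linarith)
  have h := (h₁.const_mul (θ₂ * β)).add (h₂.const_mul θ₃)
  simp only [mul_zero, add_zero, neg_neg] at h
  refine h.congr fun T => ?_
  unfold expPerturbation
  ring

theorem alpha1_sq {β θ₂ θ₃ T : ℝ} (α γ θ₁ H : ℝ)
    (hD : 0 < β ^ 2 - 2 * expPerturbation β θ₂ θ₃ T) :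
    alpha1 β α γ θ₁ θ₂ θ₃ H T ^ 2 =
      (γ * θ₁ * T ^ (H - 1) + α) ^ 2 *
        (1 + 2 * expPerturbation β θ₂ θ₃ T / (β ^ 2 - 2 * expPerturbation β θ₂ θ₃ T)) := by
  have hb : beta1 β θ₂ θ₃ T ^ 2 = β ^ 2 - 2 * expPerturbation β θ₂ θ₃ T := by
    rw [beta1, neg_sq]
    exact Real.sq_sqrt hD.le
  rw [alpha1, div_pow, hb]
  field_simp
  ring

theorem sq_rpow_sub_one_mul_wH {T : ℝ} (H : ℝ) (hT : 0 < T) :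
    (T ^ (H - 1)) ^ 2 * wH H T = (lambdaH H)⁻¹ := by
  have h : (T ^ (H - 1)) ^ 2 * T ^ (2 - 2 * H) = 1 := by
    rw [← Real.rpow_mul_natCast hT.le, ← Real.rpow_add hT]
    convert Real.rpow_zero T using 2
    push_cast
    ring
  rw [wH, mul_left_comm, h, mul_one]

/-- Limit of the exponent term:
`(α₁(T)² − α²)/(2γ²) · w_T^H − (θ₁α/γ) T^{H−1} w_T^H → θ₁²/(2λ_H)` as `T → ∞`. -/
theorem stmt_8 (β α γ θ₁ θ₂ θ₃ H : ℝ) (hβ : β < 0) (hγ : 0 < γ)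
    (hH₁ : 1 / 2 < H) (hH₂ : H < 1) :
    Tendsto
      (fun T : ℝ =>
        ((alpha1 β α γ θ₁ θ₂ θ₃ H T) ^ 2 - α ^ 2) / (2 * γ ^ 2) * wH H T
          - (θ₁ * α / γ) * T ^ (H - 1) * wH H T)
      atTop (nhds (θ₁ ^ 2 / (2 * lambdaH H))) := by
  have he : Tendsto (expPerturbation β θ₂ θ₃) atTop (nhds 0) := by
    simpa using tendsto_expPerturbation_mul_rpow θ₂ θ₃ 0 hβ
  have hD : Tendsto (fun T => β ^ 2 - 2 * expPerturbation β θ₂ θ₃ T) atTop (nhds (β ^ 2)) := by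
    simpa using (he.const_mul 2).const_sub (β ^ 2)
  have hβ2 : 0 < β ^ 2 := sq_pos_of_neg hβ
  have hx : Tendsto (fun T : ℝ => T ^ (H - 1)) atTop (nhds 0) := by
    simpa using tendsto_rpow_neg_atTop (show 0 < 1 - H by linarith)
  have hlin : Tendsto (fun T : ℝ => γ * θ₁ * T ^ (H - 1) + α) atTop (nhds α) := by
    simpa using (hx.const_mul (γ * θ₁)).add_const α
  have hew := (tendsto_expPerturbation_mul_rpow θ₂ θ₃ (2 - 2 * H) hβ).const_mul
    ((lambdaH H)⁻¹ / γ ^ 2)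
  have hrem := (((hlin.pow 2).mul hew).div hD hβ2.ne').const_add (θ₁ ^ 2 / (2 * lambdaH H))
  simp only [mul_zero, zero_div, add_zero] at hrem
  refine hrem.congr' ?_
  filter_upwards [hD.eventually_const_lt hβ2, eventually_gt_atTop 0] with T hDT hT
  have hmain : θ₁ ^ 2 / (2 * lambdaH H) = θ₁ ^ 2 / 2 * ((T ^ (H - 1)) ^ 2 * wH H T) := by
    rw [sq_rpow_sub_one_mul_wH H hT, div_mul_eq_div_div, div_eq_mul_inv]
  simp only [Pi.div_apply]
  rw [alpha1_sq α γ θ₁ H hDT, hmain]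
  unfold wH
  generalize (lambdaH H)⁻¹ = l
  field_simp
  ring
end
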